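/- For every prime p, the group K_p is not Hilbert–Schmidt stable: there exist a sequence of positive integers (n_k) and functions π_k : K_p → U(n_k) with lim_k ‖π_k(gh) − π_k(g)π_k(h)‖₂ = 0 for all g, h ∈ K_p, such that for every sequence of group homomorphisms σ_k : K_p → U(n_k) there is some g ∈ K_p with ‖π_k(g) − σ_k(g)‖₂ not converging to 0. -/

import Mathlib

def Zp (p : ℕ) : AddSubgroup ℚ where
  carrier := {q : ℚ | ∃ (k : ℤ) (n : ℕ), q * (p : ℚ) ^ n = (k : ℚ)}
  zero_mem' := ⟨0, 0, by norm_num⟩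
  add_mem' := by
    rintro a b ⟨k1, n1, h1⟩ ⟨k2, n2, h2⟩
    refine ⟨k1 * (p : ℤ) ^ n2 + k2 * (p : ℤ) ^ n1, n1 + n2, ?_⟩
    push_cast
    calc (a + b) * (p : ℚ) ^ (n1 + n2)
        = a * (p : ℚ) ^ n1 * (p : ℚ) ^ n2 + b * (p : ℚ) ^ n2 * (p : ℚ) ^ n1 := by
          rw [pow_add]; ring
      _ = (k1 : ℚ) * (p : ℚ) ^ n2 + (k2 : ℚ) * (p : ℚ) ^ n1 := by rw [h1, h2]
  neg_mem' := by
    rintro a ⟨k, n, h⟩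
    refine ⟨-k, n, ?_⟩
    push_cast
    rw [neg_mul, h]

lemma Zp.mul_mem {p : ℕ} {a b : ℚ} (ha : a ∈ Zp p) (hb : b ∈ Zp p) : a * b ∈ Zp p := by
  obtain ⟨k1, n1, h1⟩ := ha
  obtain ⟨k2, n2, h2⟩ := hb
  refine ⟨k1 * k2, n1 + n2, ?_⟩
  push_cast
  calc a * b * (p : ℚ) ^ (n1 + n2) = (a * (p : ℚ) ^ n1) * (b * (p : ℚ) ^ n2) := by
        rw [pow_add]; ring
    _ = (k1 : ℚ) * (k2 : ℚ) := by rw [h1, h2]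

lemma Zp.intCast_mem (p : ℕ) (k : ℤ) : (k : ℚ) ∈ Zp p := ⟨k, 0, by norm_num⟩

lemma Zp.zpow_mem {p : ℕ} (hp : (p : ℚ) ≠ 0) (n : ℤ) : (p : ℚ) ^ n ∈ Zp p := by
  rcases n with k | k
  · refine ⟨(p : ℤ) ^ k, 0, ?_⟩
    push_cast
    simp
  · refine ⟨1, k + 1, ?_⟩
    rw [zpow_negSucc]
    push_cast
    rw [inv_mul_cancel₀ (pow_ne_zero _ hp)]

/-- Membership predicate for the group `K_p`: upper triangular `5 × 5` matrices with
rows `(1, x₁₂, 0, x₁₄, x₁₅)`, `(0, pⁿ, 0, x₂₄, x₂₅)`, `(0,0,1,0,0)`, `(0,0,0,1,m)`,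
`(0,0,0,0,1)` where the `xᵢⱼ ∈ ℤ[1/p]`, `n, m ∈ ℤ`. -/
def KpPred (p : ℕ) (M : Matrix (Fin 5) (Fin 5) ℚ) : Prop :=
  (∃ n : ℤ, M 1 1 = (p : ℚ) ^ n) ∧ (∃ m : ℤ, M 3 4 = (m : ℚ)) ∧
  M 0 0 = 1 ∧ M 2 2 = 1 ∧ M 3 3 = 1 ∧ M 4 4 = 1 ∧
  M 0 1 ∈ Zp p ∧ M 0 3 ∈ Zp p ∧ M 0 4 ∈ Zp p ∧ M 1 3 ∈ Zp p ∧ M 1 4 ∈ Zp p ∧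
  M 0 2 = 0 ∧ M 1 2 = 0 ∧ M 2 3 = 0 ∧ M 2 4 = 0 ∧
  M 1 0 = 0 ∧ M 2 0 = 0 ∧ M 2 1 = 0 ∧
  M 3 0 = 0 ∧ M 3 1 = 0 ∧ M 3 2 = 0 ∧
  M 4 0 = 0 ∧ M 4 1 = 0 ∧ M 4 2 = 0 ∧ M 4 3 = 0

/-- The group `K_p`, as a subgroup of the units of the `5 × 5` matrices over `ℚ`. -/
def Kp (p : ℕ) (hp : p.Prime) : Subgroup (Matrix (Fin 5) (Fin 5) ℚ)ˣ where
  carrier := {M | KpPred p M.val}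
  one_mem' := by
    refine ⟨⟨0, ?_⟩, ⟨0, ?_⟩, ?_, ?_, ?_, ?_, ?_, ?_, ?_, ?_, ?_, ?_, ?_, ?_, ?_, ?_, ?_,
      ?_, ?_, ?_, ?_, ?_, ?_, ?_, ?_⟩ <;>
      simp [Matrix.one_apply, (Zp p).zero_mem]
  mul_mem' := by
    have hp0 : (p : ℚ) ≠ 0 := Nat.cast_ne_zero.mpr hp.ne_zero
    rintro A B ⟨⟨na, a11⟩, ⟨ma, a34⟩, a00, a22, a33, a44, a01, a03, a04, a13, a14,
      a02, a12, a23, a24, a10, a20, a21, a30, a31, a32, a40, a41, a42, a43⟩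
      ⟨⟨nb, b11⟩, ⟨mb, b34⟩, b00, b22, b33, b44, b01, b03, b04, b13, b14,
      b02, b12, b23, b24, b10, b20, b21, b30, b31, b32, b40, b41, b42, b43⟩
    have e : ∀ i j, (A.val * B.val) i j =
        A.val i 0 * B.val 0 j + A.val i 1 * B.val 1 j + A.val i 2 * B.val 2 j +
          A.val i 3 * B.val 3 j + A.val i 4 * B.val 4 j := by
      intro i j
      rw [Matrix.mul_apply, Fin.sum_univ_five]
    refine ⟨⟨na + nb, ?_⟩, ⟨ma + mb, ?_⟩, ?_, ?_, ?_, ?_, ?_, ?_, ?_, ?_, ?_, ?_, ?_, ?_,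
      ?_, ?_, ?_, ?_, ?_, ?_, ?_, ?_, ?_, ?_, ?_⟩ <;>
      simp only [Units.val_mul, e, a11, a34, a00, a22, a33, a44, a02, a12, a23, a24,
        a10, a20, a21, a30, a31, a32, a40, a41, a42, a43,
        b11, b34, b00, b22, b33, b44, b02, b12, b23, b24,
        b10, b20, b21, b30, b31, b32, b40, b41, b42, b43,
        one_mul, mul_one, mul_zero, zero_mul, add_zero, zero_add]
    · exact (zpow_add₀ hp0 na nb).symm
    · push_cast; ring
    · exact (Zp p).add_mem b01 (Zp.mul_mem a01 (Zp.zpow_mem hp0 nb))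
    · exact (Zp p).add_mem ((Zp p).add_mem b03 (Zp.mul_mem a01 b13)) a03
    · exact (Zp p).add_mem ((Zp p).add_mem ((Zp p).add_mem b04 (Zp.mul_mem a01 b14))
        (Zp.mul_mem a03 (Zp.intCast_mem p mb))) a04
    · exact (Zp p).add_mem (Zp.mul_mem (Zp.zpow_mem hp0 na) b13) a13
    · exact (Zp p).add_mem ((Zp p).add_mem (Zp.mul_mem (Zp.zpow_mem hp0 na) b14)
        (Zp.mul_mem a13 (Zp.intCast_mem p mb))) a14
  inv_mem' := by
    have hp0 : (p : ℚ) ≠ 0 := Nat.cast_ne_zero.mpr hp.ne_zero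
    rintro A ⟨⟨na, a11⟩, ⟨ma, a34⟩, a00, a22, a33, a44, a01, a03, a04, a13, a14,
      a02, a12, a23, a24, a10, a20, a21, a30, a31, a32, a40, a41, a42, a43⟩
    have hu : A.val 1 1 ≠ 0 := by
      rw [a11]; exact zpow_ne_zero _ hp0
    have hinv : (A⁻¹).val =
        !![1, -(A.val 0 1) * (A.val 1 1)⁻¹, 0,
             A.val 0 1 * A.val 1 3 * (A.val 1 1)⁻¹ - A.val 0 3,
             -(A.val 0 1) * (A.val 1 3 * A.val 3 4 - A.val 1 4) * (A.val 1 1)⁻¹ +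
               A.val 0 3 * A.val 3 4 - A.val 0 4;
           0, (A.val 1 1)⁻¹, 0, -(A.val 1 3) * (A.val 1 1)⁻¹,
             (A.val 1 3 * A.val 3 4 - A.val 1 4) * (A.val 1 1)⁻¹;
           0, 0, 1, 0, 0;
           0, 0, 0, 1, -(A.val 3 4);
           0, 0, 0, 0, 1] := by
      apply Units.inv_eq_of_mul_eq_one_right
      ext i j
      rw [Matrix.mul_apply, Fin.sum_univ_five]
      fin_cases i <;> fin_cases j <;>
        simp [Matrix.one_apply, Matrix.vecHead, Matrix.vecTail,
          a00, a22, a33, a44, a02, a12, a23, a24, a10, a20, a21, a30, a31, a32,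
          a40, a41, a42, a43, -mul_eq_zero] <;>
        field_simp <;>
        ring
    refine ⟨⟨-na, ?_⟩, ⟨-ma, ?_⟩, ?_, ?_, ?_, ?_, ?_, ?_, ?_, ?_, ?_, ?_, ?_, ?_, ?_, ?_,
      ?_, ?_, ?_, ?_, ?_, ?_, ?_, ?_, ?_⟩ <;> rw [hinv]
    · show (A.val 1 1)⁻¹ = (p : ℚ) ^ (-na)
      rw [a11, ← zpow_neg]
    · show -(A.val 3 4) = ((-ma : ℤ) : ℚ)
      rw [a34]; push_cast; ring
    · show (1 : ℚ) = 1; rfl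
    · show (1 : ℚ) = 1; rfl
    · show (1 : ℚ) = 1; rfl
    · show (1 : ℚ) = 1; rfl
    · show -(A.val 0 1) * (A.val 1 1)⁻¹ ∈ Zp p
      rw [a11, ← zpow_neg]
      exact Zp.mul_mem ((Zp p).neg_mem a01) (Zp.zpow_mem hp0 (-na))
    · show A.val 0 1 * A.val 1 3 * (A.val 1 1)⁻¹ - A.val 0 3 ∈ Zp p
      rw [a11, ← zpow_neg]
      exact (Zp p).sub_mem (Zp.mul_mem (Zp.mul_mem a01 a13) (Zp.zpow_mem hp0 (-na))) a03
    · show -(A.val 0 1) * (A.val 1 3 * A.val 3 4 - A.val 1 4) * (A.val 1 1)⁻¹ +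
          A.val 0 3 * A.val 3 4 - A.val 0 4 ∈ Zp p
      rw [a11, ← zpow_neg, a34]
      refine (Zp p).sub_mem ((Zp p).add_mem ?_ ?_) a04
      · exact Zp.mul_mem (Zp.mul_mem ((Zp p).neg_mem a01)
          ((Zp p).sub_mem (Zp.mul_mem a13 (Zp.intCast_mem p ma)) a14)) (Zp.zpow_mem hp0 (-na))
      · exact Zp.mul_mem a03 (Zp.intCast_mem p ma)
    · show -(A.val 1 3) * (A.val 1 1)⁻¹ ∈ Zp p
      rw [a11, ← zpow_neg]
      exact Zp.mul_mem ((Zp p).neg_mem a13) (Zp.zpow_mem hp0 (-na))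
    · show (A.val 1 3 * A.val 3 4 - A.val 1 4) * (A.val 1 1)⁻¹ ∈ Zp p
      rw [a11, ← zpow_neg, a34]
      exact Zp.mul_mem ((Zp p).sub_mem (Zp.mul_mem a13 (Zp.intCast_mem p ma)) a14)
        (Zp.zpow_mem hp0 (-na))
    · show (0 : ℚ) = 0; rfl
    · show (0 : ℚ) = 0; rfl
    · show (0 : ℚ) = 0; rfl
    · show (0 : ℚ) = 0; rfl
    · show (0 : ℚ) = 0; rfl
    · show (0 : ℚ) = 0; rfl
    · show (0 : ℚ) = 0; rfl
    · show (0 : ℚ) = 0; rfl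
    · show (0 : ℚ) = 0; rfl
    · show (0 : ℚ) = 0; rfl
    · show (0 : ℚ) = 0; rfl
    · show (0 : ℚ) = 0; rfl
    · show (0 : ℚ) = 0; rfl
    · show (0 : ℚ) = 0; rfl

/-- The normalized Hilbert–Schmidt norm `‖A‖₂ = (Tr_n(A*A))^{1/2}` of an `n × n`
complex matrix, where `Tr_n` is the normalized trace. -/
noncomputable def hsNorm (n : ℕ) (A : Matrix (Fin n) (Fin n) ℂ) : ℝ :=
  Real.sqrt ((A.conjTranspose * A).trace.re / n)

section HilbertSchmidtNorm

open Matrix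

variable {n : ℕ}

lemma hsNorm_eq_sqrt_sum (A : Matrix (Fin n) (Fin n) ℂ) :
    hsNorm n A = √((∑ i, ∑ j, ‖A i j‖ ^ 2) / n) := by
  unfold hsNorm
  congr 2
  rw [Matrix.trace, Complex.re_sum, Finset.sum_comm]
  refine Finset.sum_congr rfl fun i _ => ?_
  rw [Matrix.diag_apply, Matrix.mul_apply, Complex.re_sum]
  refine Finset.sum_congr rfl fun j _ => ?_
  rw [Matrix.conjTranspose_apply, RCLike.star_def, ← Complex.normSq_eq_conj_mul_self,
    Complex.ofReal_re, Complex.normSq_eq_norm_sq]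

open scoped Matrix.Norms.Frobenius in
lemma hsNorm_eq_frobenius (A : Matrix (Fin n) (Fin n) ℂ) :
    hsNorm n A = ‖A‖ / √n := by
  rw [hsNorm_eq_sqrt_sum, Matrix.frobenius_norm_def, Real.sqrt_div (by positivity),
    Real.sqrt_eq_rpow]
  simp

open scoped Matrix.Norms.Frobenius in
lemma hsNorm_add_le (A B : Matrix (Fin n) (Fin n) ℂ) :
    hsNorm n (A + B) ≤ hsNorm n A + hsNorm n B := by
  simp only [hsNorm_eq_frobenius, ← add_div]
  gcongr
  exact norm_add_le A B

open scoped Matrix.Norms.Frobenius in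
lemma hsNorm_sub_comm (A B : Matrix (Fin n) (Fin n) ℂ) :
    hsNorm n (A - B) = hsNorm n (B - A) := by
  simp only [hsNorm_eq_frobenius, norm_sub_rev A B]

lemma hsNorm_sub_le (A B C : Matrix (Fin n) (Fin n) ℂ) :
    hsNorm n (A - C) ≤ hsNorm n (A - B) + hsNorm n (B - C) := by
  simpa using hsNorm_add_le (A - B) (B - C)

lemma hsNorm_nonneg (A : Matrix (Fin n) (Fin n) ℂ) : 0 ≤ hsNorm n A := Real.sqrt_nonneg _

lemma hsNorm_unitary_mul (W : unitaryGroup (Fin n) ℂ) (A : Matrix (Fin n) (Fin n) ℂ) :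
    hsNorm n ((W : Matrix (Fin n) (Fin n) ℂ) * A) = hsNorm n A := by
  have hW : (W : Matrix (Fin n) (Fin n) ℂ)ᴴ * (W : Matrix (Fin n) (Fin n) ℂ) = 1 :=
    UnitaryGroup.star_mul_self W
  unfold hsNorm
  rw [conjTranspose_mul, Matrix.mul_assoc, ← Matrix.mul_assoc _ (W : Matrix (Fin n) (Fin n) ℂ) A,
    hW, Matrix.one_mul]

lemma hsNorm_mul_unitary (A : Matrix (Fin n) (Fin n) ℂ) (W : unitaryGroup (Fin n) ℂ) :
    hsNorm n (A * (W : Matrix (Fin n) (Fin n) ℂ)) = hsNorm n A := by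
  have hW : (W : Matrix (Fin n) (Fin n) ℂ) * (W : Matrix (Fin n) (Fin n) ℂ)ᴴ = 1 :=
    Unitary.mul_star_self_of_mem W.2
  unfold hsNorm
  rw [conjTranspose_mul, Matrix.mul_assoc, Matrix.trace_mul_comm, Matrix.mul_assoc,
    Matrix.mul_assoc, hW, Matrix.mul_one]

lemma hsNorm_sub_one_le_of_mul_eq {U V Z : unitaryGroup (Fin n) ℂ} (h : U * V = Z * V * U) :
    hsNorm n ((Z : Matrix (Fin n) (Fin n) ℂ) - 1) ≤
      2 * hsNorm n ((U : Matrix (Fin n) (Fin n) ℂ) - 1) := by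
  have h' : (U : Matrix (Fin n) (Fin n) ℂ) * V = Z * V * U := by
    simpa using congrArg Subtype.val h
  have e1 : hsNorm n ((Z : Matrix (Fin n) (Fin n) ℂ) - 1) =
      hsNorm n ((Z : Matrix (Fin n) (Fin n) ℂ) * V - V) := by
    rw [← hsNorm_mul_unitary _ V, sub_mul, one_mul]
  have e2 : hsNorm n ((Z : Matrix (Fin n) (Fin n) ℂ) * V - U * V) =
      hsNorm n ((U : Matrix (Fin n) (Fin n) ℂ) - 1) := by
    rw [h', hsNorm_sub_comm, ← hsNorm_unitary_mul (Z * V) ((U : Matrix (Fin n) (Fin n) ℂ) - 1)]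
    simp [mul_sub]
  have e3 : hsNorm n ((U : Matrix (Fin n) (Fin n) ℂ) * V - V) =
      hsNorm n ((U : Matrix (Fin n) (Fin n) ℂ) - 1) := by
    rw [← hsNorm_mul_unitary ((U : Matrix (Fin n) (Fin n) ℂ) - 1) V, sub_mul, one_mul]
  have := hsNorm_sub_le ((Z : Matrix (Fin n) (Fin n) ℂ) * (V : Matrix (Fin n) (Fin n) ℂ))
    ((U : Matrix (Fin n) (Fin n) ℂ) * (V : Matrix (Fin n) (Fin n) ℂ)) V
  linarith

end HilbertSchmidtNorm

section CentralCommutator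

/-- An eigenvalue of a central commutator of invertible operators is a root of unity. -/
lemma Module.End.HasEigenvalue.pow_finrank_factorial_eq_one {K E : Type*} [Field K]
    [AddCommGroup E] [Module K E] [FiniteDimensional K E] {a b z : Module.End K E}
    (ha : Function.Injective a) (hb : Function.Injective b) (hza : Commute z a)
    (hzb : Commute z b) (h : a * b = z * b * a) {μ : K} (hμ : z.HasEigenvalue μ) :
    μ ^ (Module.finrank K E).factorial = 1 := by
  set W := z.eigenspace μ
  have hinv : ∀ c : Module.End K E, Commute z c → ∀ x ∈ W, c x ∈ W := by
    intro c hc x hx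
    rw [Module.End.mem_eigenspace_iff] at hx ⊢
    rw [← Module.End.mul_apply, hc.eq, Module.End.mul_apply, hx, map_smul]
  set a' := a.restrict (hinv a hza)
  set b' := b.restrict (hinv b hzb)
  have hdet : ∀ c : Module.End K E, ∀ hc : Commute z c, Function.Injective c →
      LinearMap.det (c.restrict (hinv c hc)) ≠ 0 := by
    intro c hc hci h0
    obtain ⟨x, hx, hx0⟩ := (Submodule.ne_bot_iff _).1 (LinearMap.bot_lt_ker_of_det_eq_zero h0).ne'
    apply hx0
    have : c x = 0 := by simpa using congrArg Subtype.val (LinearMap.mem_ker.1 hx)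
    exact Subtype.ext (hci (by simpa using this))
  have hab : a' * b' = μ • (b' * a') := by
    ext x
    have h1 := LinearMap.congr_fun h (x : E)
    have h2 : z (b (a x)) = μ • b (a x) :=
      Module.End.mem_eigenspace_iff.1 (hinv b hzb _ (hinv a hza _ x.2))
    simpa [a', b', h2] using h1
  have hd := congrArg LinearMap.det hab
  rw [LinearMap.det_smul, map_mul, map_mul, mul_comm (LinearMap.det b')] at hd
  have hpow : μ ^ Module.finrank K W = 1 :=
    (mul_eq_right₀ (mul_ne_zero (hdet a hza ha) (hdet b hzb hb))).1 hd.symm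
  have hpos : 0 < Module.finrank K W := by
    have : Nontrivial W := (Submodule.nontrivial_iff_ne_bot).2 hμ
    exact Module.finrank_pos
  obtain ⟨k, hk⟩ := Nat.dvd_factorial hpos (Submodule.finrank_le W)
  rw [hk, pow_mul, hpow, one_pow]

open Matrix in
open scoped Matrix.Norms.L2Operator in
/-- A central commutator of unitary `n × n` matrices has order dividing `n!`. -/
lemma unitaryGroup_pow_factorial_eq_one {n : ℕ} {a b z : unitaryGroup (Fin n) ℂ}
    (hza : Commute z a) (hzb : Commute z b) (h : a * b = z * b * a) :
    z ^ n.factorial = 1 := by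
  let T : Matrix (Fin n) (Fin n) ℂ ≃ₐ[ℂ] Module.End ℂ (Fin n → ℂ) := Matrix.toLinAlgEquiv'
  have hinj : ∀ c : unitaryGroup (Fin n) ℂ, Function.Injective (T c) := by
    intro c
    have : (T ((c⁻¹ : unitaryGroup (Fin n) ℂ) : Matrix (Fin n) (Fin n) ℂ)) * T c = 1 := by
      rw [← map_mul, ← map_one T]
      congr 1
      exact congrArg Subtype.val (inv_mul_cancel c)
    exact Function.LeftInverse.injective (g := T ((c⁻¹ : unitaryGroup (Fin n) ℂ) : Matrix _ _ ℂ))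
      (fun x => LinearMap.congr_fun this x)
  have hval : ∀ {c d : unitaryGroup (Fin n) ℂ}, c = d →
      T (c : Matrix (Fin n) (Fin n) ℂ) = T (d : Matrix (Fin n) (Fin n) ℂ) := fun h => by rw [h]
  have hspec : ∀ μ ∈ spectrum ℂ (z : Matrix (Fin n) (Fin n) ℂ), μ ^ n.factorial = 1 := by
    intro μ hμ
    have hμ' : (T z).HasEigenvalue μ := by
      rw [Module.End.hasEigenvalue_iff_mem_spectrum, AlgEquiv.spectrum_eq]
      exact hμ
    simpa using hμ'.pow_finrank_factorial_eq_one (hinj a) (hinj b)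
      (show _ = _ by simpa using hval hza.eq)
      (show _ = _ by simpa using hval hzb.eq) (by simpa using hval h)
  apply Subtype.ext
  have hn : IsStarNormal ((z ^ n.factorial : unitaryGroup (Fin n) ℂ) : Matrix (Fin n) (Fin n) ℂ) :=
    inferInstance
  refine CFC.eq_one_of_spectrum_subset_one (R := ℂ) _ ?_ hn
  intro ν hν
  rw [SubmonoidClass.coe_pow, spectrum.map_pow_of_pos _ n.factorial_pos] at hν
  obtain ⟨μ, hμ, rfl⟩ := hν
  exact hspec μ hμ

end CentralCommutator

namespace Kp

section Heisenberg

variable {p : ℕ} {hp : p.Prime}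

/-- The element of `K_p` with `x₁₄ = y`, `x₁₅ = z`, lower right entry `m` and trivial remaining
entries. -/
def heis (hp : p.Prime) (y z : Zp p) (m : ℤ) : Kp p hp :=
  ⟨⟨!![1, 0, 0, y, z; 0, 1, 0, 0, 0; 0, 0, 1, 0, 0; 0, 0, 0, 1, m; 0, 0, 0, 0, 1],
    !![1, 0, 0, -y, y * m - z; 0, 1, 0, 0, 0; 0, 0, 1, 0, 0; 0, 0, 0, 1, -m; 0, 0, 0, 0, 1],
    by
      ext i j
      rw [Matrix.mul_apply, Fin.sum_univ_five]
      fin_cases i <;> fin_cases j <;> simp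
      ring,
    by
      ext i j
      rw [Matrix.mul_apply, Fin.sum_univ_five]
      fin_cases i <;> fin_cases j <;> simp
      ring⟩,
    ⟨0, by simp⟩, ⟨m, by simp⟩, by simp, by simp, by simp, by simp,
    (Zp p).zero_mem, y.2, z.2, (Zp p).zero_mem, (Zp p).zero_mem,
    by simp, by simp, by simp, by simp, by simp, by simp, by simp, by simp, by simp, by simp,
    by simp, by simp, by simp, by simp⟩

lemma heis_mul (y z y' z' : Zp p) (m m' : ℤ) :
    heis hp y z m * heis hp y' z' m' = heis hp (y + y') (z + z' + m' • y) (m + m') := by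
  apply Subtype.ext
  apply Units.ext
  ext i j
  change (Matrix.of _ * Matrix.of _ : Matrix (Fin 5) (Fin 5) ℚ) i j = _
  rw [Matrix.mul_apply, Fin.sum_univ_five]
  fin_cases i <;> fin_cases j <;> simp [heis] <;> ring

lemma heis_pow (z : Zp p) (k : ℕ) : heis hp 0 z 0 ^ k = heis hp 0 (k • z) 0 := by
  induction k with
  | zero =>
    apply Subtype.ext
    apply Units.ext
    ext i j
    fin_cases i <;> fin_cases j <;> simp [heis]
  | succ k ih => rw [pow_succ, ih, heis_mul, succ_nsmul]; simp

/-- The element `p⁻ᵏ` of `ℤ[1/p]`. -/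
def invPow (hp : p.Prime) (k : ℕ) : Zp p :=
  ⟨(p : ℚ) ^ (-k : ℤ), Zp.zpow_mem (Nat.cast_ne_zero.2 hp.ne_zero) _⟩

lemma pow_nsmul_invPow (a k : ℕ) : p ^ a • invPow hp (a + k) = invPow hp k := by
  have : (p : ℚ) ≠ 0 := Nat.cast_ne_zero.2 hp.ne_zero
  apply Subtype.ext
  simp only [invPow, AddSubgroup.coe_nsmul, nsmul_eq_mul, Nat.cast_pow]
  rw [← zpow_natCast, ← zpow_add₀ this]
  congr 1
  push_cast
  ring

/-- In a finite-dimensional unitary representation, the central element `1/p` acts with finite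
order prime to `p`, so it is a power of the central element `1`. -/
lemma exists_map_heis_eq_pow {n : ℕ} (σ : Kp p hp →* Matrix.unitaryGroup (Fin n) ℂ) :
    ∃ j : ℕ, σ (heis hp 0 (invPow hp 1) 0) = σ (heis hp 0 (j • invPow hp 0) 0) := by
  obtain ⟨a, b, hb, hab⟩ := Nat.exists_eq_pow_mul_and_not_dvd n.factorial_ne_zero p hp.ne_one
  have key : ∀ z : Zp p, σ (heis hp 0 z 0) ^ n.factorial = 1 := by
    intro z
    refine unitaryGroup_pow_factorial_eq_one (a := σ (heis hp z 0 0)) (b := σ (heis hp 0 0 1))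
      ?_ ?_ ?_ <;>
    simp only [Commute, SemiconjBy, ← map_mul, heis_mul] <;> simp
  have hord : σ (heis hp 0 (invPow hp 1) 0) ^ b = 1 := by
    have := key (invPow hp (a + 1))
    rwa [hab, pow_mul, ← map_pow, heis_pow, pow_nsmul_invPow] at this
  have hcop : p.Coprime (orderOf (σ (heis hp 0 (invPow hp 1) 0))) :=
    Nat.Coprime.of_dvd_right (orderOf_dvd_of_pow_eq_one hord) ((hp.coprime_iff_not_dvd).2 hb)
  obtain ⟨j, hj⟩ := exists_pow_eq_self_of_coprime hcop
  refine ⟨j, ?_⟩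
  conv_lhs => rw [← hj]
  have h1 := pow_nsmul_invPow (hp := hp) 1 0
  rw [← map_pow, ← map_pow, heis_pow, heis_pow, ← h1, pow_one]

lemma hsNorm_map_heis_sub_one_le {n : ℕ} (σ : Kp p hp →* Matrix.unitaryGroup (Fin n) ℂ) :
    hsNorm n ((σ (heis hp 0 (invPow hp 1) 0) : Matrix (Fin n) (Fin n) ℂ) - 1) ≤
      2 * hsNorm n ((σ (heis hp (invPow hp 0) 0 0) : Matrix (Fin n) (Fin n) ℂ) - 1) := by
  obtain ⟨j, hj⟩ := exists_map_heis_eq_pow σ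
  rw [hj]
  refine hsNorm_sub_one_le_of_mul_eq (V := σ (heis hp 0 0 j)) ?_
  simp only [← map_mul, heis_mul]
  simp

end Heisenberg

section Entries

variable {p : ℕ} {hp : p.Prime}

/-- The entries of an element of `K_p`. -/
abbrev entry (g : Kp p hp) (i j : Fin 5) : ℚ := g.1.val i j

/-- The integer `m` attached to an element of `K_p`. -/
def shift (g : Kp p hp) : ℤ := (entry g 3 4).num

lemma coe_shift (g : Kp p hp) : (shift g : ℚ) = entry g 3 4 := by
  obtain ⟨m, hm⟩ := g.2.2.1
  simp only [shift, entry]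
  rw [hm, Rat.num_intCast]

lemma entry_one_one_mem (g : Kp p hp) : entry g 1 1 ∈ Zp p := by
  obtain ⟨n, hn⟩ := g.2.1
  rw [entry, hn]
  exact Zp.zpow_mem (Nat.cast_ne_zero.2 hp.ne_zero) n

lemma entry_mul (g h : Kp p hp) :
    entry (g * h) 0 1 = entry h 0 1 + entry g 0 1 * entry h 1 1 ∧
    entry (g * h) 1 1 = entry g 1 1 * entry h 1 1 ∧
    entry (g * h) 0 3 = entry h 0 3 + entry g 0 1 * entry h 1 3 + entry g 0 3 ∧
    entry (g * h) 0 4 =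
      entry h 0 4 + entry g 0 1 * entry h 1 4 + entry g 0 3 * entry h 3 4 + entry g 0 4 ∧
    entry (g * h) 1 3 = entry g 1 1 * entry h 1 3 + entry g 1 3 ∧
    entry (g * h) 1 4 = entry g 1 1 * entry h 1 4 + entry g 1 3 * entry h 3 4 + entry g 1 4 ∧
    entry (g * h) 3 4 = entry h 3 4 + entry g 3 4 := by
  obtain ⟨A, ⟨na, a11⟩, ⟨ma, a34⟩, a00, a22, a33, a44, a01, a03, a04, a13, a14,
      a02, a12, a23, a24, a10, a20, a21, a30, a31, a32, a40, a41, a42, a43⟩ := g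
  obtain ⟨B, ⟨nb, b11⟩, ⟨mb, b34⟩, b00, b22, b33, b44, b01, b03, b04, b13, b14,
      b02, b12, b23, b24, b10, b20, b21, b30, b31, b32, b40, b41, b42, b43⟩ := h
  have e : ∀ i j, (A.val * B.val) i j =
      A.val i 0 * B.val 0 j + A.val i 1 * B.val 1 j + A.val i 2 * B.val 2 j +
        A.val i 3 * B.val 3 j + A.val i 4 * B.val 4 j := by
    intro i j
    rw [Matrix.mul_apply, Fin.sum_univ_five]
  simp only [entry]
  simp [*]

lemma shift_mul (g h : Kp p hp) : shift (g * h) = shift h + shift g := by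
  have := (entry_mul g h).2.2.2.2.2.2
  simp only [← coe_shift] at this
  exact_mod_cast this

end Entries

end Kp

section Monomial

variable {n : ℕ} {ι : Type*} [DecidableEq ι]

/-- The unitary monomial matrix with permutation `s` and phases `d`, in coordinates given by
`e`. -/
noncomputable def monomialUnitary (e : Fin n ≃ ι) (s : Equiv.Perm ι) (d : ι → Circle) :
    Matrix.unitaryGroup (Fin n) ℂ :=
  ⟨Matrix.of fun i j => if s (e i) = e j then (d (e i) : ℂ) else 0, by
    rw [Matrix.mem_unitaryGroup_iff]
    ext i j
    rw [Matrix.mul_apply, Finset.sum_eq_single (e.symm (s (e i)))]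
    · by_cases hij : i = j
      · subst hij
        simp [Matrix.star_apply, Complex.mul_conj]
      · have : s (e j) ≠ s (e i) := fun h => hij (e.injective (s.injective h)).symm
        simp [Matrix.star_apply, Matrix.one_apply_ne hij, this]
    · intro b _ hb
      have : s (e i) ≠ e b := fun h => hb (by simp [h])
      simp [this]
    · simp⟩

lemma monomialUnitary_apply (e : Fin n ≃ ι) (s : Equiv.Perm ι) (d : ι → Circle) (i j : Fin n) :
    (monomialUnitary e s d : Matrix (Fin n) (Fin n) ℂ) i j =
      if s (e i) = e j then (d (e i) : ℂ) else 0 := rfl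

lemma monomialUnitary_one (e : Fin n ≃ ι) : monomialUnitary e 1 (fun _ => 1) = 1 := by
  apply Subtype.ext
  ext i j
  simp [monomialUnitary_apply, Matrix.one_apply]

lemma monomialUnitary_mul (e : Fin n ≃ ι) (s s' : Equiv.Perm ι) (d d' : ι → Circle) :
    monomialUnitary e s d * monomialUnitary e s' d' =
      monomialUnitary e (s.trans s') (fun x => d x * d' (s x)) := by
  apply Subtype.ext
  ext i j
  rw [Matrix.UnitaryGroup.mul_val, Matrix.mul_apply, Finset.sum_eq_single (e.symm (s (e i)))]
  · by_cases h : s' (s (e i)) = e j <;> simp [monomialUnitary_apply, h]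
  · intro b _ hb
    have : s (e i) ≠ e b := fun h => hb (by simp [h])
    simp [monomialUnitary_apply, this]
  · simp

lemma hsNorm_monomialUnitary_sub [Fintype ι] (e : Fin n ≃ ι) (s : Equiv.Perm ι)
    (d d' : ι → Circle) :
    hsNorm n ((monomialUnitary e s d : Matrix (Fin n) (Fin n) ℂ) - monomialUnitary e s d') =
      √((∑ x, ‖(d x : ℂ) - d' x‖ ^ 2) / n) := by
  rw [hsNorm_eq_sqrt_sum, ← Equiv.sum_comp e]
  congr 2
  refine Finset.sum_congr rfl fun i _ => ?_
  rw [Finset.sum_eq_single (e.symm (s (e i)))]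
  · simp [monomialUnitary_apply]
  · intro b _ hb
    have : s (e i) ≠ e b := fun h => hb (by simp [h])
    simp [monomialUnitary_apply, this]
  · simp

lemma hsNorm_monomialUnitary_one_sub_one_le [Fintype ι] (e : Fin n ≃ ι) (d : ι → Circle) {c : ℝ}
    (hc : 0 ≤ c) (hd : ∀ x, ‖(d x : ℂ) - 1‖ ≤ c) :
    hsNorm n ((monomialUnitary e 1 d : Matrix (Fin n) (Fin n) ℂ) - 1) ≤ c := by
  have h1 : (1 : Matrix (Fin n) (Fin n) ℂ) = (monomialUnitary e 1 (fun _ => 1)) := by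
    rw [monomialUnitary_one]; rfl
  rw [h1, hsNorm_monomialUnitary_sub, Real.sqrt_le_left hc]
  refine div_le_of_le_mul₀ (Nat.cast_nonneg _) (by positivity) ?_
  calc ∑ x, ‖(d x : ℂ) - (1 : Circle)‖ ^ 2 ≤ ∑ _x : ι, c ^ 2 := by
        gcongr with x
        simpa using hd x
    _ = c ^ 2 * n := by
        rw [Finset.sum_const, Finset.card_univ, ← Fintype.card_congr e, Fintype.card_fin,
          nsmul_eq_mul, mul_comm]

lemma hsNorm_monomialUnitary_one_const [Fintype ι] (hn : 0 < n) (e : Fin n ≃ ι) (c : Circle) :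
    hsNorm n ((monomialUnitary e 1 (fun _ => c) : Matrix (Fin n) (Fin n) ℂ) - 1) =
      ‖(c : ℂ) - 1‖ := by
  have h1 : (1 : Matrix (Fin n) (Fin n) ℂ) = (monomialUnitary e 1 (fun _ => 1)) := by
    rw [monomialUnitary_one]; rfl
  have hn' : (n : ℝ) ≠ 0 := by positivity
  rw [h1, hsNorm_monomialUnitary_sub, Finset.sum_const, Finset.card_univ, ← Fintype.card_congr e,
    Fintype.card_fin, nsmul_eq_mul, mul_div_cancel_left₀ _ hn', Real.sqrt_sq (norm_nonneg _)]
  simp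

end Monomial

/-- Translation by `m` on `ZMod L` commutes with the lift to `ℤ` off at most `2 |m|` points. -/
lemma card_val_add_intCast_ne_le (L : ℕ) [NeZero L] (m : ℤ) :
    (Finset.univ.filter fun j : ZMod L => ((j + (m : ZMod L)).val : ℤ) ≠ j.val + m).card ≤
      2 * m.natAbs := by
  have hsub : (Finset.univ.filter fun j : ZMod L => ((j + (m : ZMod L)).val : ℤ) ≠ j.val + m).image
      ZMod.val ⊆ Finset.range m.natAbs ∪ Finset.Ico (L - m.natAbs) L := by
    intro v hv
    obtain ⟨j, hj, rfl⟩ := Finset.mem_image.1 hv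
    have hj' := (Finset.mem_filter.1 hj).2
    have hlt := ZMod.val_lt j
    rw [Finset.mem_union, Finset.mem_range, Finset.mem_Ico]
    by_contra hcon
    apply hj'
    have h1 : ((j.val + m : ℤ) : ZMod L) = j + (m : ZMod L) := by
      push_cast
      rw [ZMod.natCast_zmod_val]
    rw [← h1, ZMod.val_intCast, Int.emod_eq_of_lt] <;> omega
  calc _ = ((Finset.univ.filter fun j : ZMod L =>
          ((j + (m : ZMod L)).val : ℤ) ≠ j.val + m).image ZMod.val).card :=
        (Finset.card_image_of_injective _ (ZMod.val_injective L)).symm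
    _ ≤ _ := Finset.card_le_card hsub
    _ ≤ _ := Finset.card_union_le _ _
    _ ≤ 2 * m.natAbs := by
        rw [Finset.card_range, Nat.card_Ico]
        omega

lemma Circle.norm_sub_le_two (a b : Circle) : ‖(a : ℂ) - b‖ ≤ 2 := by
  refine (norm_sub_le _ _).trans ?_
  rw [Circle.norm_coe, Circle.norm_coe]
  norm_num

/-- Reduction modulo a prime `N` different from `p` is well behaved on `ℤ[1/p]`. -/
lemma Zp.den_ne_zero {p N : ℕ} [Fact N.Prime] (hpN : (p : ZMod N) ≠ 0) {q : ℚ} (hq : q ∈ Zp p) :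
    (q.den : ZMod N) ≠ 0 := by
  obtain ⟨k, n, h⟩ := hq
  have hp0 : (p : ℚ) ≠ 0 := by
    intro h0
    exact hpN (by rw [Nat.cast_eq_zero.1 h0, Nat.cast_zero])
  have hq : q = ((k : ℤ) : ℚ) / ((p ^ n : ℕ) : ℤ) := by
    push_cast
    rw [eq_div_iff (pow_ne_zero _ hp0), h]
  have hdvd : q.den ∣ p ^ n := by
    have := Rat.den_dvd k ((p ^ n : ℕ) : ℤ)
    rw [Rat.divInt_eq_div, ← hq] at this
    exact_mod_cast this
  intro h0
  obtain ⟨c, hc⟩ := hdvd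
  apply pow_ne_zero n hpN
  rw [← Nat.cast_pow, hc, Nat.cast_mul, h0, zero_mul]

lemma Zp.cast_add {p N : ℕ} [Fact N.Prime] (hpN : (p : ZMod N) ≠ 0) {a b : ℚ} (ha : a ∈ Zp p)
    (hb : b ∈ Zp p) : ((a + b : ℚ) : ZMod N) = a + b :=
  Rat.cast_add_of_ne_zero (den_ne_zero hpN ha) (den_ne_zero hpN hb)

lemma Zp.cast_mul {p N : ℕ} [Fact N.Prime] (hpN : (p : ZMod N) ≠ 0) {a b : ℚ} (ha : a ∈ Zp p)
    (hb : b ∈ Zp p) : ((a * b : ℚ) : ZMod N) = a * b :=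
  Rat.cast_mul_of_ne_zero (den_ne_zero hpN ha) (den_ne_zero hpN hb)

namespace Kp

section ApproximateRepresentation

variable {p : ℕ} {hp : p.Prime} {N : ℕ} [Fact N.Prime]

lemma cast_entry_one_one_ne_zero (hpN : (p : ZMod N) ≠ 0) (g : Kp p hp) :
    (entry g 1 1 : ZMod N) ≠ 0 := by
  intro h0
  have h1 : entry (g * g⁻¹) 1 1 = entry g 1 1 * entry g⁻¹ 1 1 := (entry_mul g g⁻¹).2.1
  have h2 : ((entry g 1 1 * entry g⁻¹ 1 1 : ℚ) : ZMod N) = 0 := by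
    rw [Zp.cast_mul hpN (entry_one_one_mem g) (entry_one_one_mem _), h0, zero_mul]
  rw [← h1, mul_inv_cancel] at h2
  simp [entry] at h2

/-- The entry of the row `(1, t, 0, 0)` times `g` times the column `(0, 0, j, 1)`, modulo `N`. -/
def phase (N : ℕ) [Fact N.Prime] (g : Kp p hp) (t j : ZMod N) : ZMod N :=
  entry g 0 4 + entry g 0 3 * j + t * (entry g 1 3 * j + entry g 1 4)

lemma phase_mul (hpN : (p : ZMod N) ≠ 0) (g h : Kp p hp) (t j : ZMod N) :
    phase N (g * h) t j = phase N g t (j + (shift h : ZMod N)) +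
      phase N h (t * (entry g 1 1 : ZMod N) + (entry g 0 1 : ZMod N)) j := by
  obtain ⟨e01, e11, e03, e04, e13, e14, e34⟩ := entry_mul g h
  have hg := g.2.2.2.2.2.2.2
  have hh := h.2.2.2.2.2.2.2
  obtain ⟨g01, g03, g04, g13, g14, -⟩ := hg
  obtain ⟨h01, h03, h04, h13, h14, -⟩ := hh
  have g11 := entry_one_one_mem g
  have hm : ((shift h : ℚ) : ZMod N) = (shift h : ZMod N) := Rat.cast_intCast _
  have hs : (shift h : ℚ) ∈ Zp p := Zp.intCast_mem p _
  rw [← coe_shift h] at e04 e14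
  have A := fun {a b : ℚ} => @Zp.cast_add p N _ hpN a b
  have M := fun {a b : ℚ} => @Zp.cast_mul p N _ hpN a b
  have m := fun {a b : ℚ} => @Zp.mul_mem p a b
  have s := fun {a b : ℚ} => @AddSubgroup.add_mem _ _ (Zp p) a b
  simp only [phase]
  rw [e03, e04, e13, e14, A (s h03 (m g01 h13)) g03, A h03 (m g01 h13), M g01 h13,
    A (s (s h04 (m g01 h14)) (m g03 hs)) g04, A (s h04 (m g01 h14)) (m g03 hs),
    A h04 (m g01 h14), M g01 h14, M g03 hs, A (m g11 h13) g13, M g11 h13,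
    A (s (m g11 h14) (m g13 hs)) g14, A (m g11 h14) (m g13 hs), M g11 h14, M g13 hs, hm]
  ring

/-- The action of `g` on `ℤ/N × ℤ/L`. -/
def step (hpN : (p : ZMod N) ≠ 0) (L : ℕ) (g : Kp p hp) : Equiv.Perm (ZMod N × ZMod L) :=
  Equiv.prodCongr
    ((Equiv.mulRight₀ _ (cast_entry_one_one_ne_zero hpN g)).trans
      (Equiv.addRight (entry g 0 1 : ZMod N)))
    (Equiv.subRight (shift g : ZMod L))

lemma step_apply (hpN : (p : ZMod N) ≠ 0) (L : ℕ) (g : Kp p hp) (x : ZMod N × ZMod L) :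
    step hpN L g x =
      (x.1 * (entry g 1 1 : ZMod N) + (entry g 0 1 : ZMod N), x.2 - (shift g : ZMod L)) :=
  rfl

lemma step_mul (hpN : (p : ZMod N) ≠ 0) (L : ℕ) (g h : Kp p hp) :
    step hpN L (g * h) = (step hpN L g).trans (step hpN L h) := by
  obtain ⟨e01, e11, -⟩ := entry_mul g h
  have g01 := g.2.2.2.2.2.2.2.1
  have h01 := h.2.2.2.2.2.2.2.1
  have g11 := entry_one_one_mem g
  have h11 := entry_one_one_mem h
  ext x
  · rw [Equiv.trans_apply]
    simp only [step_apply]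
    rw [e01, e11, Zp.cast_mul hpN g11 h11, Zp.cast_add hpN h01 (Zp.mul_mem g01 h11),
      Zp.cast_mul hpN g01 h11]
    ring
  · rw [Equiv.trans_apply]
    simp only [step_apply, shift_mul]
    push_cast
    ring

/-- The phases of the approximate representation. -/
noncomputable def twist (N L : ℕ) [Fact N.Prime] (g : Kp p hp) (x : ZMod N × ZMod L) : Circle :=
  ZMod.toCircle (-phase N g x.1 ((x.2 - (shift g : ZMod L)).val : ZMod N))

lemma twist_mul (hpN : (p : ZMod N) ≠ 0) {L : ℕ} (g h : Kp p hp) (x : ZMod N × ZMod L)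
    (hx : ((x.2 - (shift (g * h) : ZMod L) + (shift h : ZMod L)).val : ℤ) =
      (x.2 - (shift (g * h) : ZMod L)).val + shift h) :
    twist N L (g * h) x = twist N L g x * twist N L h (step hpN L g x) := by
  have e1 : x.2 - (shift g : ZMod L) =
      x.2 - (shift (g * h) : ZMod L) + (shift h : ZMod L) := by
    rw [shift_mul]; push_cast; ring
  have e2 : x.2 - (shift g : ZMod L) - (shift h : ZMod L) = x.2 - (shift (g * h) : ZMod L) := by
    rw [shift_mul]; push_cast; ring
  have e3 := congrArg (fun a : ℤ => (a : ZMod N)) hx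
  push_cast at e3
  simp only [twist, step_apply]
  rw [e2, e1, ← AddChar.map_add_eq_mul, phase_mul hpN, ← e3, neg_add]

lemma step_heis (hpN : (p : ZMod N) ≠ 0) (L : ℕ) (y z : Zp p) :
    step hpN L (heis hp y z 0) = 1 := by
  ext x <;> rw [step_apply] <;> simp [heis, entry, shift]

variable {n L : ℕ} [NeZero L]

lemma hsNorm_approx_mul_sub_le (hpN : (p : ZMod N) ≠ 0) (e : Fin n ≃ ZMod N × ZMod L)
    (g h : Kp p hp) :
    hsNorm n ((monomialUnitary e (step hpN L (g * h)) (twist N L (g * h)) :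
        Matrix (Fin n) (Fin n) ℂ) -
      (monomialUnitary e (step hpN L g) (twist N L g) : Matrix (Fin n) (Fin n) ℂ) *
        (monomialUnitary e (step hpN L h) (twist N L h) : Matrix (Fin n) (Fin n) ℂ)) ≤
      √(8 * (shift h).natAbs / L) := by
  have hcard : n = N * L := by
    have := Fintype.card_congr e
    rwa [Fintype.card_fin, Fintype.card_prod, ZMod.card, ZMod.card] at this
  have hN : (N : ℝ) ≠ 0 := Nat.cast_ne_zero.2 (Fact.out : N.Prime).ne_zero
  have hL : (L : ℝ) ≠ 0 := Nat.cast_ne_zero.2 (NeZero.ne L)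
  rw [← Matrix.UnitaryGroup.mul_val, monomialUnitary_mul, step_mul, hsNorm_monomialUnitary_sub]
  apply Real.sqrt_le_sqrt
  set bad : ZMod L → Prop := fun j => ((j + (shift h : ZMod L)).val : ℤ) ≠ j.val + shift h
  have hpt : ∀ x : ZMod N × ZMod L, ‖((twist N L (g * h) x : Circle) : ℂ) -
      (twist N L g x * twist N L h (step hpN L g x) : Circle)‖ ^ 2 ≤
      if bad (x.2 - (shift (g * h) : ZMod L)) then 4 else 0 := by
    intro x
    split_ifs with hb
    · have := Circle.norm_sub_le_two (twist N L (g * h) x)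
        (twist N L g x * twist N L h (step hpN L g x))
      nlinarith [norm_nonneg (((twist N L (g * h) x : Circle) : ℂ) -
        (twist N L g x * twist N L h (step hpN L g x) : Circle))]
    · rw [← twist_mul hpN g h x (not_not.1 hb)]
      simp
  have hsum : ∑ x : ZMod N × ZMod L, ‖((twist N L (g * h) x : Circle) : ℂ) -
      (twist N L g x * twist N L h (step hpN L g x) : Circle)‖ ^ 2 ≤
      N * (4 * (2 * (shift h).natAbs)) := by
    calc _ ≤ ∑ x : ZMod N × ZMod L,
          (if bad (x.2 - (shift (g * h) : ZMod L)) then (4 : ℝ) else 0) :=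
          Finset.sum_le_sum fun x _ => hpt x
      _ = N * (4 * (Finset.univ.filter bad).card) := by
          have hin : ∑ j : ZMod L, (if bad (j - (shift (g * h) : ZMod L)) then (4 : ℝ) else 0) =
              4 * (Finset.univ.filter bad).card := by
            refine ((Equiv.subRight (shift (g * h) : ZMod L)).sum_comp
              (fun j => if bad j then (4 : ℝ) else 0)).trans ?_
            rw [← Finset.sum_filter, Finset.sum_const, nsmul_eq_mul, mul_comm]
          rw [Fintype.sum_prod_type, Finset.sum_congr rfl fun _ _ => hin, Finset.sum_const,
            Finset.card_univ, ZMod.card, nsmul_eq_mul]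
      _ ≤ N * (4 * (2 * (shift h).natAbs)) := by
          gcongr
          exact_mod_cast card_val_add_intCast_ne_le L (shift h)
  calc _ ≤ N * (4 * (2 * ((shift h).natAbs : ℝ))) / n := by gcongr
    _ = 8 * (shift h).natAbs / L := by
        rw [hcard]
        push_cast
        field_simp
        ring

lemma twist_heis (y z : Zp p) (x : ZMod N × ZMod L) :
    twist N L (heis hp y z 0) x =
      ZMod.toCircle (-(((z : ℚ) : ZMod N) + ((y : ℚ) : ZMod N) * (x.2.val : ZMod N))) := by
  simp [twist, phase, heis, entry, shift]

end ApproximateRepresentation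

end Kp

lemma tendsto_const_div_natCast_add_one (c : ℝ) :
    Filter.Tendsto (fun k : ℕ => c / ((k : ℝ) + 1)) Filter.atTop (nhds 0) := by
  simpa [div_eq_mul_inv] using (tendsto_one_div_add_atTop_nhds_zero_nat (𝕜 := ℝ)).const_mul c

lemma Complex.norm_exp_I_mul_sub_exp_I_mul_le (a b : ℝ) :
    ‖Complex.exp (Complex.I * a) - Complex.exp (Complex.I * b)‖ ≤ |a - b| := by
  have h : Complex.exp (Complex.I * a) - Complex.exp (Complex.I * b) =
      Complex.exp (b * Complex.I) * (Complex.exp (Complex.I * (a - b : ℝ)) - 1) := by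
    rw [mul_sub, ← Complex.exp_add, mul_one, mul_comm (b : ℂ)]
    congr 2
    push_cast
    ring
  rw [h, norm_mul, Complex.norm_exp_ofReal_mul_I, one_mul]
  exact Real.norm_exp_I_mul_ofReal_sub_one_le

lemma ZMod.coe_toCircle_intCast {N : ℕ} [NeZero N] (j : ℤ) :
    ((ZMod.toCircle (j : ZMod N) : Circle) : ℂ) =
      Complex.exp (Complex.I * (2 * Real.pi * j / N : ℝ)) := by
  rw [ZMod.toCircle_intCast]
  congr 1
  push_cast
  ring

/-- Approximate representations of `K_p` in which `x₁₄ = 1` is nearly trivial, while `x₁₅ = 1/p`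
acts nearly as the scalar `exp (2πi/p)`. -/
lemma Kp.exists_approx (p : ℕ) (hp : p.Prime) (k : ℕ) :
    ∃ n : ℕ, 0 < n ∧ ∃ π : Kp p hp → Matrix.unitaryGroup (Fin n) ℂ,
      (∀ g h : Kp p hp, hsNorm n ((π (g * h) : Matrix (Fin n) (Fin n) ℂ) -
        (π g : Matrix (Fin n) (Fin n) ℂ) * (π h : Matrix (Fin n) (Fin n) ℂ)) ≤
          √(8 * (shift h).natAbs / (k + 1))) ∧
      hsNorm n ((π (heis hp (invPow hp 0) 0 0) : Matrix (Fin n) (Fin n) ℂ) - 1) ≤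
        2 * Real.pi / (k + 1) ∧
      ‖Complex.exp (2 * Real.pi * Complex.I / p) - 1‖ ≤
        hsNorm n ((π (heis hp 0 (invPow hp 1) 0) : Matrix (Fin n) (Fin n) ℂ) - 1) +
          2 * Real.pi / (k + 1) := by
  obtain ⟨N, hN, hlt, hmod⟩ := Nat.exists_prime_gt_modEq_one ((k + 1) ^ 2 + p) hp.ne_zero
  have : Fact N.Prime := ⟨hN⟩
  have hpN : (p : ZMod N) ≠ 0 := by
    rw [Ne, ZMod.natCast_eq_zero_iff]
    intro h
    have := Nat.le_of_dvd hp.pos h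
    nlinarith
  obtain ⟨r, hr⟩ : p ∣ N - 1 := (Nat.modEq_iff_dvd' hN.one_le).1 hmod.symm
  have hNr : N = p * r + 1 := by have := hN.one_le; omega
  have hNpos : (0 : ℝ) < N := Nat.cast_pos.2 hN.pos
  have hppos : (0 : ℝ) < p := Nat.cast_pos.2 hp.pos
  have hNk : ((k : ℝ) + 1) ^ 2 ≤ N := by
    have : (k + 1) ^ 2 ≤ N := by omega
    exact_mod_cast this
  let n := Fintype.card (ZMod N × ZMod (k + 1))
  let e : Fin n ≃ ZMod N × ZMod (k + 1) := (Fintype.equivFin _).symm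
  have hn : 0 < n := Fintype.card_pos
  refine ⟨n, hn, fun g => monomialUnitary e (step hpN (k + 1) g) (twist N (k + 1) g),
    fun g h => ?_, ?_, ?_⟩
  · simpa using hsNorm_approx_mul_sub_le hpN e g h
  · dsimp only
    rw [step_heis]
    refine hsNorm_monomialUnitary_one_sub_one_le e _ (by positivity) fun x => ?_
    have hval : (x.2.val : ℝ) ≤ k + 1 := by exact_mod_cast (ZMod.val_lt x.2).le
    have hphase : twist N (k + 1) (heis hp (invPow hp 0) 0 0) x =
        ZMod.toCircle ((-(x.2.val : ℤ) : ℤ) : ZMod N) := by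
      rw [twist_heis]
      simp [invPow]
    rw [hphase, ZMod.coe_toCircle_intCast]
    refine Real.norm_exp_I_mul_ofReal_sub_one_le.trans ?_
    rw [Real.norm_eq_abs, abs_div, abs_mul, abs_of_pos Real.two_pi_pos, abs_of_pos hNpos,
      div_le_div_iff₀ hNpos (by positivity)]
    push_cast
    rw [abs_neg, Nat.abs_cast, mul_assoc]
    refine mul_le_mul_of_nonneg_left ?_ Real.two_pi_pos.le
    nlinarith
  · have hinv : ((invPow hp 1 : ℚ) : ZMod N) = -(r : ZMod N) := by
      apply mul_left_cancel₀ hpN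
      have h1 : (((p : ℚ) * (invPow hp 1 : ℚ) : ℚ) : ZMod N) = p * ((invPow hp 1 : ℚ) : ZMod N) := by
        have := Zp.cast_mul hpN (Zp.intCast_mem p p) (invPow hp 1).2
        simpa using this
      have h2 : (p : ℚ) * (invPow hp 1 : ℚ) = 1 := by
        have : (p : ℚ) ≠ 0 := Nat.cast_ne_zero.2 hp.ne_zero
        simp [invPow, this]
      have h3 : ((p * r + 1 : ℕ) : ZMod N) = 0 := by rw [← hNr, ZMod.natCast_self]
      rw [← h1, h2, Rat.cast_one]
      push_cast at h3
      linear_combination h3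
    have hphase : twist N (k + 1) (heis hp 0 (invPow hp 1) 0) =
        fun _ => ZMod.toCircle ((r : ℤ) : ZMod N) := by
      ext x
      rw [twist_heis, hinv]
      simp
    dsimp only
    rw [step_heis, hphase, hsNorm_monomialUnitary_one_const hn, ZMod.coe_toCircle_intCast]
    set a : ℝ := 2 * Real.pi * (r : ℤ) / N
    have hω : Complex.exp (2 * Real.pi * Complex.I / p) =
        Complex.exp (Complex.I * (2 * Real.pi / p : ℝ)) := by
      congr 1
      push_cast
      ring
    have hdist : |2 * Real.pi / p - a| ≤ 2 * Real.pi / (k + 1) := by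
      have : 2 * Real.pi / p - a = 2 * Real.pi / (p * N) := by
        have hNr' : (N : ℝ) = p * r + 1 := by exact_mod_cast hNr
        simp only [a]
        field_simp
        rw [hNr']
        push_cast
        ring
      rw [this, abs_of_nonneg (by positivity)]
      have hp1 : (1 : ℝ) ≤ p := by exact_mod_cast hp.one_le
      gcongr
      nlinarith
    rw [hω]
    calc _ ≤ ‖Complex.exp (Complex.I * (2 * Real.pi / p : ℝ)) - Complex.exp (Complex.I * a)‖ +
          ‖Complex.exp (Complex.I * a) - 1‖ := norm_sub_le_norm_sub_add_norm_sub _ _ _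
      _ ≤ _ := by
        have := Complex.norm_exp_I_mul_sub_exp_I_mul_le (2 * Real.pi / p) a
        linarith

/-- `K_p` is not Hilbert–Schmidt stable. -/
theorem Kp_not_HS_stable (p : ℕ) (hp : p.Prime) :
    ∃ (n : ℕ → ℕ), (∀ k, 0 < n k) ∧
      ∃ π : ∀ k, ↥(Kp p hp) → Matrix.unitaryGroup (Fin (n k)) ℂ,
        (∀ g h : ↥(Kp p hp),
          Filter.Tendsto (fun k =>
            hsNorm (n k) ((π k (g * h) : Matrix (Fin (n k)) (Fin (n k)) ℂ) -
              (π k g : Matrix (Fin (n k)) (Fin (n k)) ℂ) *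
                (π k h : Matrix (Fin (n k)) (Fin (n k)) ℂ))) Filter.atTop (nhds 0)) ∧
        ∀ σ : ∀ k, ↥(Kp p hp) →* Matrix.unitaryGroup (Fin (n k)) ℂ,
          ∃ g : ↥(Kp p hp),
            ¬ Filter.Tendsto (fun k =>
                hsNorm (n k) ((π k g : Matrix (Fin (n k)) (Fin (n k)) ℂ) -
                  (σ k g : Matrix (Fin (n k)) (Fin (n k)) ℂ))) Filter.atTop (nhds 0) := by
  choose n hn π hmul hU hZ using Kp.exists_approx p hp
  refine ⟨n, hn, π, fun g h => ?_, fun σ => ?_⟩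
  · have hlim : Filter.Tendsto (fun k : ℕ => √(8 * (Kp.shift h).natAbs / ((k : ℝ) + 1)))
        Filter.atTop (nhds 0) := by
      have : Filter.Tendsto (fun k : ℕ => 8 * ((Kp.shift h).natAbs : ℝ) / ((k : ℝ) + 1))
          Filter.atTop (nhds 0) := tendsto_const_div_natCast_add_one _
      simpa using this.sqrt
    exact squeeze_zero (fun k => hsNorm_nonneg _) (fun k => hmul k g h) hlim
  · by_contra! hcon
    set u := Kp.heis hp (Kp.invPow hp 0) 0 0
    set z := Kp.heis hp 0 (Kp.invPow hp 1) 0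
    have hc : Filter.Tendsto (fun k : ℕ => 2 * Real.pi / ((k : ℝ) + 1)) Filter.atTop (nhds 0) :=
      tendsto_const_div_natCast_add_one _
    have hlim := (((((hcon u).add hc).const_mul 2).add (hcon z)).add hc)
    have hle : ‖Complex.exp (2 * Real.pi * Complex.I / p) - 1‖ ≤ 2 * (0 + 0) + 0 + 0 := by
      refine ge_of_tendsto' hlim fun k => (hZ k).trans ?_
      have h1 := hsNorm_sub_le (π k z : Matrix (Fin (n k)) (Fin (n k)) ℂ)
        (σ k z : Matrix (Fin (n k)) (Fin (n k)) ℂ) 1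
      have h2 : hsNorm (n k) ((σ k z : Matrix (Fin (n k)) (Fin (n k)) ℂ) - 1) ≤
          2 * hsNorm (n k) ((σ k u : Matrix (Fin (n k)) (Fin (n k)) ℂ) - 1) :=
        Kp.hsNorm_map_heis_sub_one_le (σ k)
      have h3 := hsNorm_sub_le (σ k u : Matrix (Fin (n k)) (Fin (n k)) ℂ)
        (π k u : Matrix (Fin (n k)) (Fin (n k)) ℂ) 1
      rw [hsNorm_sub_comm _ (π k u : Matrix (Fin (n k)) (Fin (n k)) ℂ)] at h3
      have h4 := hU k
      linarith
    refine (Complex.isPrimitiveRoot_exp p hp.ne_zero).ne_one hp.one_lt ?_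
    rw [← sub_eq_zero, ← norm_le_zero_iff]
    simpa using hle
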